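/- Define A := Ψᵀ D_μ (I − γP) (I − λγP)⁻¹ Ψ and b := Ψᵀ D_μ (I − λγP)⁻¹ r. A vector θ ∈ ℝ^d satisfies A θ = b if and only if Ψθ is a fixed point of the projected multi-step Bellman operator, i.e., Ψθ = Π_G T^λ (Ψθ). Consequently, since A is invertible, V := Ψ A⁻¹ b is the unique solution of V = Π_G T^λ V. -/

import Mathlib

open Matrix

section AuxiliaryLemmas

/-- A full-column-rank matrix acts injectively on column vectors. -/
theorem mulVec_injective_of_rank_eq {m n : Type*} [Fintype m] [Fintype n]
    {M : Matrix m n ℝ} (h : M.rank = Fintype.card n) : Function.Injective M.mulVec := by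
  rw [Matrix.mulVec_injective_iff, linearIndependent_iff_card_eq_finrank_span, ← h,
    Matrix.rank_eq_finrank_span_cols]
  rfl

variable {n : Type*} [Fintype n]

/-- Jensen's inequality for one averaging step of a stochastic matrix. -/
theorem sq_mulVec_le_mulVec_sq {P : Matrix n n ℝ} (hP0 : ∀ x y, 0 ≤ P x y)
    (hP1 : ∀ x, ∑ y, P x y = 1) (w : n → ℝ) (x : n) :
    P.mulVec w x ^ 2 ≤ ∑ y, P x y * w y ^ 2 := by
  set m := P.mulVec w x with hm
  have hm' : ∑ y, P x y * w y = m := rfl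
  have h : 0 ≤ ∑ y, P x y * (w y - m) ^ 2 :=
    Finset.sum_nonneg fun y _ => mul_nonneg (hP0 x y) (sq_nonneg _)
  have e : ∑ y, P x y * (w y - m) ^ 2 =
      ∑ y, P x y * w y ^ 2 - 2 * m * ∑ y, P x y * w y + m ^ 2 * ∑ y, P x y := by
    rw [Finset.mul_sum, Finset.mul_sum, ← Finset.sum_sub_distrib, ← Finset.sum_add_distrib]
    exact Finset.sum_congr rfl fun y _ => by ring
  rw [hP1, hm'] at e
  linarith

/-- A stochastic matrix is nonexpansive in the `L²` norm of a stationary distribution. -/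
theorem sum_mul_sq_mulVec_le {μ : n → ℝ} (hμ : ∀ x, 0 ≤ μ x) {P : Matrix n n ℝ}
    (hP0 : ∀ x y, 0 ≤ P x y) (hP1 : ∀ x, ∑ y, P x y = 1)
    (hstat : ∀ y, ∑ x, μ x * P x y = μ y) (w : n → ℝ) :
    ∑ x, μ x * P.mulVec w x ^ 2 ≤ ∑ x, μ x * w x ^ 2 := by
  calc ∑ x, μ x * P.mulVec w x ^ 2
      ≤ ∑ x, μ x * ∑ y, P x y * w y ^ 2 := Finset.sum_le_sum fun x _ =>
        mul_le_mul_of_nonneg_left (sq_mulVec_le_mulVec_sq hP0 hP1 w x) (hμ x)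
    _ = ∑ y, (∑ x, μ x * P x y) * w y ^ 2 := by
        simp_rw [Finset.mul_sum, Finset.sum_mul]
        rw [Finset.sum_comm]
        simp_rw [mul_assoc]
    _ = ∑ x, μ x * w x ^ 2 := by simp_rw [hstat]

variable [DecidableEq n]

theorem one_sub_smul_mulVec_apply (P : Matrix n n ℝ) (c : ℝ) (w : n → ℝ) (x : n) :
    ((1 : Matrix n n ℝ) - c • P).mulVec w x = w x - c * P.mulVec w x := by
  simp [Matrix.sub_mulVec, Matrix.smul_mulVec]

/-- Positivity of the bilinear form pairing `(I - λγP) w` with `(I - γP) w`. -/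
theorem sum_resolvent_pairing_pos {μ : n → ℝ} (hμ : ∀ x, 0 < μ x) {P : Matrix n n ℝ}
    (hP0 : ∀ x y, 0 ≤ P x y) (hP1 : ∀ x, ∑ y, P x y = 1)
    (hstat : ∀ y, ∑ x, μ x * P x y = μ y) {γ lam : ℝ} (hγ : γ ∈ Set.Ioo (0 : ℝ) 1)
    (hlam : lam ∈ Set.Ico (0 : ℝ) 1) {w : n → ℝ} (hw : w ≠ 0) :
    0 < ∑ x, μ x * (((1 : Matrix n n ℝ) - (lam * γ) • P).mulVec w x *
      ((1 : Matrix n n ℝ) - γ • P).mulVec w x) := by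
  obtain ⟨hγ0, hγ1⟩ := hγ
  obtain ⟨hl0, hl1⟩ := hlam
  have hT := sum_mul_sq_mulVec_le (fun x => (hμ x).le) hP0 hP1 hstat w
  have hS : 0 < ∑ x, μ x * w x ^ 2 := by
    obtain ⟨x, hx⟩ := Function.ne_iff.mp hw
    exact Finset.sum_pos' (fun y _ => mul_nonneg (hμ y).le (sq_nonneg _))
      ⟨x, Finset.mem_univ x, mul_pos (hμ x) (sq_pos_of_ne_zero hx)⟩
  have hlower : (1 - (1 + lam) * γ / 2) * ∑ x, μ x * w x ^ 2 -
      γ * ((1 + lam) / 2 - lam * γ) * ∑ x, μ x * P.mulVec w x ^ 2 ≤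
      ∑ x, μ x * (((1 : Matrix n n ℝ) - (lam * γ) • P).mulVec w x *
        ((1 : Matrix n n ℝ) - γ • P).mulVec w x) := by
    rw [Finset.mul_sum, Finset.mul_sum, ← Finset.sum_sub_distrib]
    refine Finset.sum_le_sum fun x _ => ?_
    rw [one_sub_smul_mulVec_apply, one_sub_smul_mulVec_apply]
    have h : 0 ≤ μ x * ((1 + lam) * γ / 2 * (w x - P.mulVec w x) ^ 2) := by
      have := hμ x
      positivity
    linarith
  have hlγ : lam * γ ≤ lam := mul_le_of_le_one_right hl0 hγ1.le
  have hcoef : 0 ≤ γ * ((1 + lam) / 2 - lam * γ) := mul_nonneg hγ0.le (by linarith)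
  have hgap : 0 < (1 - γ) * (1 - lam * γ) * ∑ x, μ x * w x ^ 2 :=
    mul_pos (mul_pos (by linarith) (by linarith)) hS
  linarith [mul_le_mul_of_nonneg_left hT hcoef]

theorem isUnit_of_mulVec_eq_zero {M : Matrix n n ℝ} (h : ∀ v, M.mulVec v = 0 → v = 0) :
    IsUnit M :=
  Matrix.mulVec_injective_iff_isUnit.mp ((injective_iff_map_eq_zero M.mulVecLin).mpr h)

/-- The `μ`-weighted bilinear form in matrix notation. -/
theorem dotProduct_transpose_diagonal_mulVec {m : Type*} [Fintype m] (Ψ : Matrix n m ℝ)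
    (μ : n → ℝ) (θ : m → ℝ) (v : n → ℝ) :
    θ ⬝ᵥ (Ψᵀ * Matrix.diagonal μ).mulVec v = ∑ x, μ x * (Ψ.mulVec θ x * v x) := by
  rw [← Matrix.mulVec_mulVec, Matrix.dotProduct_mulVec, Matrix.vecMul_transpose]
  simp only [dotProduct, Matrix.mulVec_diagonal]
  exact Finset.sum_congr rfl fun x _ => by ring

end AuxiliaryLemmas

/-- `A θ = b` iff `Ψθ` is a fixed point of the projected multi-step Bellman
operator `Π_G T^λ`; since `A` is invertible, `V = Ψ A⁻¹ b` is the unique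
solution of `V = Π_G T^λ V`. -/
theorem stmt_10 (NN d : ℕ) (hN : 1 ≤ NN)
    (μ : Fin NN → ℝ) (hμpos : ∀ x, 0 < μ x) (hμsum : ∑ x, μ x = 1)
    (P : Matrix (Fin NN) (Fin NN) ℝ)
    (hP0 : ∀ x y, 0 ≤ P x y) (hP1 : ∀ x, ∑ y, P x y = 1)
    (hstat : ∀ y, ∑ x, μ x * P x y = μ y)
    (γ lam : ℝ) (hγ : γ ∈ Set.Ioo (0 : ℝ) 1) (hlam : lam ∈ Set.Ico (0 : ℝ) 1)
    (r : Fin NN → ℝ)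
    (Ψ : Matrix (Fin NN) (Fin d) ℝ) (hΨ : Ψ.rank = d)
    (Tlam : (Fin NN → ℝ) → (Fin NN → ℝ))
    (hTlam : ∀ v, Tlam v =
      ((1 : Matrix (Fin NN) (Fin NN) ℝ) - (lam * γ) • P)⁻¹.mulVec r +
        ((1 - lam) * γ) •
          P.mulVec (((1 : Matrix (Fin NN) (Fin NN) ℝ) - (lam * γ) • P)⁻¹.mulVec v)) :
    let PiG := Ψ * (Ψᵀ * Matrix.diagonal μ * Ψ)⁻¹ * Ψᵀ * Matrix.diagonal μ
    let A := Ψᵀ * Matrix.diagonal μ *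
      (((1 : Matrix (Fin NN) (Fin NN) ℝ) - γ • P) *
        ((1 : Matrix (Fin NN) (Fin NN) ℝ) - (lam * γ) • P)⁻¹) * Ψ
    let b := (Ψᵀ * Matrix.diagonal μ *
      ((1 : Matrix (Fin NN) (Fin NN) ℝ) - (lam * γ) • P)⁻¹).mulVec r
    (∀ θ : Fin d → ℝ,
       A.mulVec θ = b ↔ Ψ.mulVec θ = PiG.mulVec (Tlam (Ψ.mulVec θ))) ∧
    IsUnit A ∧
    (let V := Ψ.mulVec (A⁻¹.mulVec b)
     V = PiG.mulVec (Tlam V) ∧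
       ∀ W : Fin NN → ℝ, W = PiG.mulVec (Tlam W) → W = V) := by
  set B : Matrix (Fin NN) (Fin NN) ℝ := 1 - (lam * γ) • P with hB
  intro PiG A b
  have hinj : Function.Injective Ψ.mulVec := mulVec_injective_of_rank_eq (by simpa using hΨ)
  have hΨ0 : ∀ θ, Ψ.mulVec θ = 0 → θ = 0 := fun θ h => hinj (by rw [h, Matrix.mulVec_zero])
  have hpos := fun {w : Fin NN → ℝ} (hw : w ≠ 0) =>
    sum_resolvent_pairing_pos hμpos hP0 hP1 hstat hγ hlam hw
  have hBu : IsUnit B := isUnit_of_mulVec_eq_zero fun w hw => by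
    by_contra hne
    have := hpos hne
    rw [← hB, hw] at this
    simp at this
  have hBdet := (Matrix.isUnit_iff_isUnit_det B).mp hBu
  have hGu : IsUnit (Ψᵀ * Matrix.diagonal μ * Ψ) := isUnit_of_mulVec_eq_zero fun θ hθ => by
    rw [← Matrix.mulVec_mulVec] at hθ
    have h := dotProduct_transpose_diagonal_mulVec Ψ μ θ (Ψ.mulVec θ)
    rw [hθ, dotProduct_zero, eq_comm, Finset.sum_eq_zero_iff_of_nonneg fun x _ =>
      mul_nonneg (hμpos x).le (mul_self_nonneg _)] at h
    refine hΨ0 θ (funext fun x => ?_)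
    simpa [(hμpos x).ne'] using h x (Finset.mem_univ x)
  have hGdet := (Matrix.isUnit_iff_isUnit_det _).mp hGu
  have hAu : IsUnit A := isUnit_of_mulVec_eq_zero fun θ hθ => by
    set w := B⁻¹.mulVec (Ψ.mulVec θ) with hw
    have hBw : B.mulVec w = Ψ.mulVec θ := by
      rw [hw, Matrix.mulVec_mulVec, Matrix.mul_nonsing_inv _ hBdet, Matrix.one_mulVec]
    by_contra hne
    have hw0 : w ≠ 0 := fun h => hne (hΨ0 θ (by rw [← hBw, h, Matrix.mulVec_zero]))
    have h := hpos hw0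
    have hAθ : A.mulVec θ = (Ψᵀ * Matrix.diagonal μ).mulVec
        (((1 : Matrix (Fin NN) (Fin NN) ℝ) - γ • P).mulVec w) := by
      simp only [A, hw, Matrix.mulVec_mulVec, Matrix.mul_assoc]
    rw [← hB, hBw, ← dotProduct_transpose_diagonal_mulVec, ← hAθ, hθ, dotProduct_zero] at h
    exact h.false
  have hproj : ∀ θ, PiG.mulVec (Tlam (Ψ.mulVec θ)) = Ψ.mulVec
      (θ + (Ψᵀ * Matrix.diagonal μ * Ψ)⁻¹.mulVec (b - A.mulVec θ)) := by
    intro θ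
    have hres : ((1 : Matrix (Fin NN) (Fin NN) ℝ) - γ • P) * B⁻¹ =
        1 - ((1 - lam) * γ) • (P * B⁻¹) := by
      have : (1 : Matrix (Fin NN) (Fin NN) ℝ) - γ • P = B - ((1 - lam) * γ) • P := by
        rw [hB]
        module
      rw [this, Matrix.sub_mul, Matrix.mul_nonsing_inv _ hBdet, Matrix.smul_mul]
    have hT : (Ψᵀ * Matrix.diagonal μ).mulVec (Tlam (Ψ.mulVec θ)) =
        (Ψᵀ * Matrix.diagonal μ * Ψ).mulVec θ + (b - A.mulVec θ) := by
      simp only [hTlam, A, b, hres]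
      simp only [Matrix.mul_sub, Matrix.sub_mul, Matrix.mulVec_add,
        Matrix.sub_mulVec, Matrix.mul_one, Matrix.mulVec_smul, Matrix.mul_smul,
        Matrix.smul_mul, Matrix.smul_mulVec, Matrix.mulVec_mulVec, Matrix.mul_assoc]
      abel
    have hPi : PiG = Ψ * ((Ψᵀ * Matrix.diagonal μ * Ψ)⁻¹ * (Ψᵀ * Matrix.diagonal μ)) := by
      simp only [PiG, Matrix.mul_assoc]
    rw [hPi, ← Matrix.mulVec_mulVec, ← Matrix.mulVec_mulVec, hT, Matrix.mulVec_add,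
      Matrix.mulVec_mulVec, Matrix.nonsing_inv_mul _ hGdet, Matrix.one_mulVec]
  have hiff : ∀ θ : Fin d → ℝ,
      A.mulVec θ = b ↔ Ψ.mulVec θ = PiG.mulVec (Tlam (Ψ.mulVec θ)) := by
    intro θ
    rw [hproj, hinj.eq_iff, left_eq_add]
    constructor
    · intro h
      rw [h, sub_self, Matrix.mulVec_zero]
    · intro h
      have h' := congrArg (Ψᵀ * Matrix.diagonal μ * Ψ).mulVec h
      rw [Matrix.mulVec_mulVec, Matrix.mul_nonsing_inv _ hGdet, Matrix.one_mulVec,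
        Matrix.mulVec_zero, sub_eq_zero] at h'
      exact h'.symm
  have hAdet := (Matrix.isUnit_iff_isUnit_det A).mp hAu
  refine ⟨hiff, hAu, (hiff _).mp ?_, fun W hW => ?_⟩
  · rw [Matrix.mulVec_mulVec, Matrix.mul_nonsing_inv _ hAdet, Matrix.one_mulVec]
  · obtain ⟨θ, rfl⟩ : ∃ θ, W = Ψ.mulVec θ :=
      ⟨((Ψᵀ * Matrix.diagonal μ * Ψ)⁻¹ * Ψᵀ * Matrix.diagonal μ).mulVec (Tlam W), by
        rw [Matrix.mulVec_mulVec, ← Matrix.mul_assoc, ← Matrix.mul_assoc]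
        exact hW⟩
    rw [← (hiff θ).mpr hW, Matrix.mulVec_mulVec _ A⁻¹ A, Matrix.nonsing_inv_mul _ hAdet,
      Matrix.one_mulVec]
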